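/- arXiv:2201.11967 — 2 statements merged into one kernel-verified Lean document; each statement's English description precedes it below -/
import Mathlib

section
/- For every integer k ≥ 1 there exists a constant c_k > 0 such that the k-th derivative of the GELU activation satisfies |σ^{(k)}(z)| ≤ c_k (1 + z²)^{(1-k)/2} for all z ∈ ℝ. -/
/-- The standard Gaussian cumulative distribution function
`Φ(z) = (2π)^{-1/2} ∫_{-∞}^{z} exp(-u²/2) du`. -/
noncomputable def gaussCdf (z : ℝ) : ℝ :=
  (Real.sqrt (2 * Real.pi))⁻¹ * ∫ u in Set.Iic z, Real.exp (-u ^ 2 / 2)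

/-- The GELU activation `σ(z) = z · Φ(z)`. -/
noncomputable def gelu (z : ℝ) : ℝ := z * gaussCdf z

open Polynomial in
theorem hasDerivAt_polynomial_mul_gaussian (p : ℝ[X]) (z : ℝ) :
    HasDerivAt (fun x : ℝ => p.eval x * Real.exp (-x ^ 2 / 2))
      ((derivative p - X * p).eval z * Real.exp (-z ^ 2 / 2)) z := by
  have hexp : HasDerivAt (fun x : ℝ => Real.exp (-x ^ 2 / 2))
      (Real.exp (-z ^ 2 / 2) * (-(2 * z) / 2)) z := by
    simpa using (((hasDerivAt_pow 2 z).neg).div_const 2).exp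
  refine ((p.hasDerivAt z).mul hexp).congr_deriv ?_
  simp only [eval_sub, eval_mul, eval_X]
  ring

/-- A polynomial times the Gaussian decays faster than any power of `1 + z ^ 2`. -/
theorem exists_polynomial_mul_gaussian_le (p : Polynomial ℝ) (m : ℕ) :
    ∃ C : ℝ, ∀ z : ℝ, |p.eval z| * Real.exp (-z ^ 2 / 2) * (1 + z ^ 2) ^ m ≤ C := by
  induction p using Polynomial.induction_on' with
  | add p q hp hq =>
    obtain ⟨C, hC⟩ := hp
    obtain ⟨D, hD⟩ := hq
    refine ⟨C + D, fun z => ?_⟩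
    calc |(p + q).eval z| * Real.exp (-z ^ 2 / 2) * (1 + z ^ 2) ^ m
        ≤ (|p.eval z| + |q.eval z|) * Real.exp (-z ^ 2 / 2) * (1 + z ^ 2) ^ m := by
          rw [Polynomial.eval_add]
          gcongr
          exact abs_add_le _ _
      _ ≤ C + D := by linarith [hC z, hD z]
  | monomial n a =>
    refine ⟨|a| * (2 ^ (n + m) * (n + m).factorial * Real.exp (1 / 2)), fun z => ?_⟩
    have hz : |z| ≤ 1 + z ^ 2 := by
      rw [← sq_abs]
      nlinarith [sq_nonneg (|z| - 1), abs_nonneg z]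
    have hpow := Real.pow_div_factorial_le_exp ((1 + z ^ 2) / 2) (by positivity) (n + m)
    rw [div_le_iff₀ (by positivity), div_pow, div_le_iff₀ (by positivity)] at hpow
    have hexp : Real.exp ((1 + z ^ 2) / 2) * Real.exp (-z ^ 2 / 2) = Real.exp (1 / 2) := by
      rw [← Real.exp_add]
      ring_nf
    calc |(Polynomial.monomial n a).eval z| * Real.exp (-z ^ 2 / 2) * (1 + z ^ 2) ^ m
        = |a| * (|z| ^ n * Real.exp (-z ^ 2 / 2) * (1 + z ^ 2) ^ m) := by
          rw [Polynomial.eval_monomial, abs_mul, abs_pow]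
          ring
      _ ≤ |a| * ((1 + z ^ 2) ^ n * Real.exp (-z ^ 2 / 2) * (1 + z ^ 2) ^ m) := by gcongr
      _ = |a| * ((1 + z ^ 2) ^ (n + m) * Real.exp (-z ^ 2 / 2)) := by ring
      _ ≤ |a| * (Real.exp ((1 + z ^ 2) / 2) * (n + m).factorial * 2 ^ (n + m)
            * Real.exp (-z ^ 2 / 2)) := by gcongr
      _ = _ := by rw [← hexp]; ring

theorem integrable_exp_neg_sq_div_two :
    MeasureTheory.Integrable fun u : ℝ => Real.exp (-u ^ 2 / 2) := by
  convert integrable_exp_neg_mul_sq (b := 1 / 2) (by norm_num) using 3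
  ring

theorem hasDerivAt_gaussCdf (z : ℝ) :
    HasDerivAt gaussCdf ((Real.sqrt (2 * Real.pi))⁻¹ * Real.exp (-z ^ 2 / 2)) z := by
  have hint := integrable_exp_neg_sq_div_two
  have hcont : Continuous fun u : ℝ => Real.exp (-u ^ 2 / 2) := by fun_prop
  have heq : gaussCdf = fun x : ℝ => (Real.sqrt (2 * Real.pi))⁻¹ *
      ((∫ u in (0 : ℝ)..x, Real.exp (-u ^ 2 / 2)) +
        ∫ u in Set.Iic (0 : ℝ), Real.exp (-u ^ 2 / 2)) := by
    funext x
    rw [gaussCdf, ← intervalIntegral.integral_Iic_sub_Iic hint.integrableOn hint.integrableOn,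
      sub_add_cancel]
  rw [heq]
  exact ((hcont.integral_hasStrictDerivAt 0 z).hasDerivAt.add_const _).const_mul _

theorem abs_gaussCdf_le (z : ℝ) :
    |gaussCdf z| ≤ (Real.sqrt (2 * Real.pi))⁻¹ * ∫ u : ℝ, Real.exp (-u ^ 2 / 2) := by
  have h0 : 0 ≤ ∫ u in Set.Iic z, Real.exp (-u ^ 2 / 2) :=
    MeasureTheory.integral_nonneg fun u => (Real.exp_pos _).le
  rw [gaussCdf, abs_of_nonneg (by positivity)]
  refine mul_le_mul_of_nonneg_left ?_ (by positivity)
  exact MeasureTheory.setIntegral_le_integral integrable_exp_neg_sq_div_two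
    (Filter.Eventually.of_forall fun u => (Real.exp_pos _).le)

theorem deriv_gelu :
    deriv gelu = fun z =>
      gaussCdf z + (Real.sqrt (2 * Real.pi))⁻¹ * (z * Real.exp (-z ^ 2 / 2)) := by
  funext z
  have h : HasDerivAt gelu _ z := (hasDerivAt_id' z).mul (hasDerivAt_gaussCdf z)
  rw [h.deriv]
  ring

/-- From the second order on, the derivatives of GELU are polynomials times the Gaussian. -/
theorem exists_iteratedDeriv_gelu_eq (n : ℕ) :
    ∃ p : Polynomial ℝ, iteratedDeriv (n + 2) gelu =
      fun z => p.eval z * Real.exp (-z ^ 2 / 2) := by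
  induction n with
  | zero =>
    refine ⟨.C (Real.sqrt (2 * Real.pi))⁻¹ * (1 + (Polynomial.derivative .X - .X * .X)), ?_⟩
    rw [iteratedDeriv_succ, iteratedDeriv_one, deriv_gelu]
    funext z
    have hX := hasDerivAt_polynomial_mul_gaussian .X z
    simp only [Polynomial.eval_X] at hX
    rw [((hasDerivAt_gaussCdf z).fun_add (hX.const_mul _)).deriv]
    simp only [Polynomial.eval_mul, Polynomial.eval_add, Polynomial.eval_C, Polynomial.eval_one]
    ring
  | succ n ih =>
    obtain ⟨p, hp⟩ := ih
    refine ⟨Polynomial.derivative p - .X * p, ?_⟩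
    rw [iteratedDeriv_succ, hp]
    funext z
    exact (hasDerivAt_polynomial_mul_gaussian p z).deriv

/-- For every integer `k ≥ 1` there is `c_k > 0` such that
`|σ^{(k)}(z)| ≤ c_k (1 + z²)^{(1-k)/2}` for all `z ∈ ℝ`. -/
theorem gelu_iteratedDeriv_symbol_bound (k : ℕ) (hk : 1 ≤ k) :
    ∃ c > 0, ∀ z : ℝ,
      |iteratedDeriv k gelu z| ≤ c * (1 + z ^ 2) ^ ((1 - (k : ℝ)) / 2) := by
  obtain rfl | ⟨n, rfl⟩ : k = 1 ∨ ∃ n, k = n + 2 := by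
    obtain h | h := hk.eq_or_lt
    · exact .inl h.symm
    · exact .inr ⟨k - 2, by omega⟩
  · obtain ⟨C, hC⟩ := exists_polynomial_mul_gaussian_le .X 0
    set s := (Real.sqrt (2 * Real.pi))⁻¹
    have hs : 0 ≤ s := by positivity
    set B := s * ∫ u : ℝ, Real.exp (-u ^ 2 / 2)
    refine ⟨max (B + s * C) 1, by positivity, fun z => ?_⟩
    have hCz := hC z
    simp only [Polynomial.eval_X, pow_zero, mul_one] at hCz
    rw [iteratedDeriv_one, deriv_gelu, Nat.cast_one, sub_self, zero_div, Real.rpow_zero, mul_one]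
    refine le_max_of_le_left ((abs_add_le _ _).trans (add_le_add (abs_gaussCdf_le z) ?_))
    rw [abs_mul, abs_of_nonneg hs, abs_mul, Real.abs_exp]
    gcongr
  · obtain ⟨p, hp⟩ := exists_iteratedDeriv_gelu_eq n
    obtain ⟨C, hC⟩ := exists_polynomial_mul_gaussian_le p (n + 2)
    refine ⟨max C 1, by positivity, fun z => ?_⟩
    have hz : 0 < 1 + z ^ 2 := by positivity
    rw [hp, abs_mul, Real.abs_exp]
    calc |p.eval z| * Real.exp (-z ^ 2 / 2)
        ≤ max C 1 / (1 + z ^ 2) ^ (n + 2) := by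
          rw [le_div_iff₀ (by positivity)]
          exact (hC z).trans (le_max_left _ _)
      _ = max C 1 * (1 + z ^ 2) ^ (-((n + 2 : ℕ) : ℝ)) := by
          rw [Real.rpow_neg hz.le, Real.rpow_natCast, div_eq_mul_inv]
      _ ≤ max C 1 * (1 + z ^ 2) ^ ((1 - ((n + 2 : ℕ) : ℝ)) / 2) := by
          gcongr
          · nlinarith [sq_nonneg z]
          · linarith [(Nat.cast_nonneg (n + 2) : (0 : ℝ) ≤ ((n + 2 : ℕ) : ℝ))]
end

section
/- Let m ∈ ℝ, 0 < ρ ≤ 1, 0 ≤ δ ≤ 1, and let a : ℝⁿ × ℝⁿ → ℂ be smooth, 1-periodic in each coordinate of x, and satisfy the Euclidean symbol estimates: for all multi-indices α, β there is c_{αβ} with |∂_x^β ∂_ξ^α a(x, ξ)| ≤ c_{αβ} (1 + ‖ξ‖²)^{(m - ρ|α| + δ|β|)/2} for all x, ξ ∈ ℝⁿ. Then the restriction of a to ℝⁿ × ℤⁿ satisfies the toroidal symbol estimates: for all multi-indices α, β there is c'_{αβ} with |Δ_ξ^α ∂_x^β a(x, ξ)| ≤ c'_{αβ} (1 + ‖ξ‖²)^{(m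 - ρ|α| + δ|β|)/2} for all x ∈ ℝⁿ and all ξ ∈ ℤⁿ. -/
/-- The partial derivative in the `i`-th coordinate. -/
noncomputable def pDeriv {n : ℕ} {E : Type*} [NormedAddCommGroup E] [NormedSpace ℝ E]
    (i : Fin n) (f : (Fin n → ℝ) → E) : (Fin n → ℝ) → E :=
  fun x => deriv (fun t => f (Function.update x i t)) (x i)

/-- Iterated partial derivative `∂^α = ∂₁^{α 1} ⋯ ∂ₙ^{α n}` for a multi-index `α`. -/
noncomputable def mDeriv {n : ℕ} {E : Type*} [NormedAddCommGroup E] [NormedSpace ℝ E]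
    (α : Fin n → ℕ) (f : (Fin n → ℝ) → E) : (Fin n → ℝ) → E :=
  (List.finRange n).foldr (fun i g => (pDeriv i)^[α i] g) f

/-- The mixed derivative `∂_x^β ∂_ξ^α a(x, ξ)` of a function of two variables. -/
noncomputable def mixedDeriv {n : ℕ} {E : Type*} [NormedAddCommGroup E] [NormedSpace ℝ E]
    (β α : Fin n → ℕ) (a : (Fin n → ℝ) → (Fin n → ℝ) → E) :
    (Fin n → ℝ) → (Fin n → ℝ) → E :=
  fun x ξ => mDeriv β (fun x' => mDeriv α (a x') ξ) x

/-- The forward difference operator in the `i`-th frequency variable: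
`(Δ^{e_i} g)(ξ) = g(ξ + e_i) - g(ξ)` for `g : ℤⁿ → E`. -/
def fwdDiffInt {n : ℕ} {E : Type*} [AddCommGroup E]
    (i : Fin n) (g : (Fin n → ℤ) → E) : (Fin n → ℤ) → E :=
  fun ξ => g (Function.update ξ i (ξ i + 1)) - g ξ

/-- Iterated forward difference `Δ^α = (Δ^{e_1})^{α 1} ⋯ (Δ^{e_n})^{α n}`. -/
def mFwdDiff {n : ℕ} {E : Type*} [AddCommGroup E]
    (α : Fin n → ℕ) (g : (Fin n → ℤ) → E) : (Fin n → ℤ) → E :=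
  (List.finRange n).foldr (fun i h => (fwdDiffInt i)^[α i] h) g

open scoped ContDiff

/-- The directional derivative along a fixed vector `v`. -/
noncomputable def dirDeriv {V E : Type*} [NormedAddCommGroup V] [NormedSpace ℝ V]
    [NormedAddCommGroup E] [NormedSpace ℝ E] (v : V) (f : V → E) : V → E :=
  fun p => fderiv ℝ f p v

/-- The forward difference with step `v`. -/
def stepDiff {V E : Type*} [AddCommGroup V] [AddCommGroup E] (v : V) (f : V → E) : V → E :=
  fun p => f (p + v) - f p

/-- The list containing each index `i` exactly `α i` times, in increasing order. -/
def multiIndexList {n : ℕ} (α : Fin n → ℕ) : List (Fin n) :=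
  (List.finRange n).flatMap fun i => List.replicate (α i) i

theorem foldr_iterate_eq_foldr_flatMap {ι X : Type*} (T : ι → X → X) (α : ι → ℕ)
    (l : List ι) (f : X) :
    l.foldr (fun i g => (T i)^[α i] g) f =
      (l.flatMap fun i => List.replicate (α i) i).foldr T f := by
  have replicate_foldr (i : ι) (k : ℕ) (g : X) : (List.replicate k i).foldr T g = (T i)^[k] g := by
    induction k with
    | zero => rfl
    | succ k ih => rw [List.replicate_succ, List.foldr_cons, ih, Function.iterate_succ_apply']
  induction l with
  | nil => rfl
  | cons i l ih => rw [List.foldr_cons, ih, List.flatMap_cons, List.foldr_append, replicate_foldr]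

section DirectionalDerivative

variable {ι V E : Type*} [NormedAddCommGroup V] [NormedSpace ℝ V]
  [NormedAddCommGroup E] [NormedSpace ℝ E]

theorem ContDiff.dirDeriv {f : V → E} (hf : ContDiff ℝ ∞ f) (v : V) :
    ContDiff ℝ ∞ (dirDeriv v f) :=
  (hf.fderiv_right (m := ∞) (by simp)).clm_apply contDiff_const

theorem ContDiff.foldr_dirDeriv (v : ι → V) (L : List ι) {f : V → E} (hf : ContDiff ℝ ∞ f) :
    ContDiff ℝ ∞ (L.foldr (fun i => _root_.dirDeriv (v i)) f) := by
  induction L with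
  | nil => exact hf
  | cons i L ih => exact ih.dirDeriv (v i)

theorem ContDiff.stepDiff {f : V → E} (hf : ContDiff ℝ ∞ f) (v : V) :
    ContDiff ℝ ∞ (stepDiff v f) :=
  (hf.comp (contDiff_id.add contDiff_const)).sub hf

theorem ContDiff.foldr_stepDiff (v : ι → V) (L : List ι) {f : V → E} (hf : ContDiff ℝ ∞ f) :
    ContDiff ℝ ∞ (L.foldr (fun i => _root_.stepDiff (v i)) f) := by
  induction L with
  | nil => exact hf
  | cons i L ih => exact ih.stepDiff (v i)

theorem dirDeriv_comm {f : V → E} (hf : ContDiff ℝ ∞ f) (v w : V) :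
    dirDeriv v (dirDeriv w f) = dirDeriv w (dirDeriv v f) := by
  have hd : Differentiable ℝ (fderiv ℝ f) :=
    (hf.fderiv_right (m := ∞) (by simp)).differentiable (by simp)
  have key (u z p : V) : dirDeriv u (dirDeriv z f) p = fderiv ℝ (fderiv ℝ f) p u z := by
    change fderiv ℝ (fun q => fderiv ℝ f q z) p u = _
    rw [fderiv_clm_apply (hd p) (differentiableAt_const z)]
    simp
  funext p
  have hs : IsSymmSndFDerivAt ℝ f p :=
    hf.contDiffAt.isSymmSndFDerivAt <| by
      rw [minSmoothness_of_isRCLikeNormedField]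
      exact WithTop.coe_le_coe.2 (le_top : (2 : ℕ∞) ≤ ⊤)
  rw [key, key, hs v w]

theorem dirDeriv_foldr_comm (v : ι → V) (L : List ι) {f : V → E} (hf : ContDiff ℝ ∞ f) (w : V) :
    dirDeriv w (L.foldr (fun i => dirDeriv (v i)) f) =
      L.foldr (fun i => dirDeriv (v i)) (dirDeriv w f) := by
  induction L with
  | nil => rfl
  | cons i L ih =>
    rw [List.foldr_cons, List.foldr_cons, ← ih, dirDeriv_comm (hf.foldr_dirDeriv v L)]

theorem foldr_dirDeriv_comm {κ : Type*} (v : ι → V) (w : κ → V) (L : List ι) (M : List κ)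
    {f : V → E} (hf : ContDiff ℝ ∞ f) :
    M.foldr (fun i => dirDeriv (w i)) (L.foldr (fun i => dirDeriv (v i)) f) =
      L.foldr (fun i => dirDeriv (v i)) (M.foldr (fun i => dirDeriv (w i)) f) := by
  induction M with
  | nil => rfl
  | cons i M ih =>
    rw [List.foldr_cons, List.foldr_cons, ih, dirDeriv_foldr_comm v L (hf.foldr_dirDeriv w M)]

theorem dirDeriv_stepDiff {f : V → E} (hf : ContDiff ℝ ∞ f) (v w : V) :
    dirDeriv w (stepDiff v f) = stepDiff v (dirDeriv w f) := by
  have hd : Differentiable ℝ f := hf.differentiable (by simp)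
  funext p
  have h : HasFDerivAt (stepDiff v f) (fderiv ℝ f (p + v) - fderiv ℝ f p) p :=
    ((hasFDerivAt_comp_add_right v).2 (hd (p + v)).hasFDerivAt).sub (hd p).hasFDerivAt
  simp [dirDeriv, stepDiff, h.fderiv]

theorem dirDeriv_foldr_stepDiff (v : ι → V) (L : List ι) {f : V → E} (hf : ContDiff ℝ ∞ f)
    (w : V) :
    dirDeriv w (L.foldr (fun i => stepDiff (v i)) f) =
      L.foldr (fun i => stepDiff (v i)) (dirDeriv w f) := by
  induction L with
  | nil => rfl
  | cons i L ih =>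
    rw [List.foldr_cons, List.foldr_cons, ← ih, dirDeriv_stepDiff (hf.foldr_stepDiff v L)]

/-- Mean value inequality: a forward difference is bounded by the directional derivative on the
segment it spans. -/
theorem norm_stepDiff_le {f : V → E} (hf : ContDiff ℝ ∞ f) {v p : V} {C : ℝ}
    (h : ∀ t ∈ Set.Icc (0 : ℝ) 1, ‖dirDeriv v f (p + t • v)‖ ≤ C) : ‖stepDiff v f p‖ ≤ C := by
  have hd : Differentiable ℝ f := hf.differentiable (by simp)
  have hderiv (t : ℝ) : HasDerivAt (fun t : ℝ => f (p + t • v)) (dirDeriv v f (p + t • v)) t := by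
    have hline : HasDerivAt (fun t : ℝ => p + t • v) v t := by
      simpa using ((hasDerivAt_id t).smul_const v).const_add p
    exact (hd (p + t • v)).hasFDerivAt.comp_hasDerivAt t hline
  have := norm_image_sub_le_of_norm_deriv_le_segment_01'
    (fun t _ => (hderiv t).hasDerivWithinAt) fun t ht => h t (Set.Ico_subset_Icc_self ht)
  simpa [stepDiff] using this

/-- An iterated forward difference with steps of norm at most one is bounded by the corresponding
iterated directional derivative on a ball whose radius is the number of steps. -/
theorem norm_foldr_stepDiff_le {v : ι → V} (hv : ∀ i, ‖v i‖ ≤ 1) (L : List ι) {f : V → E}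
    (hf : ContDiff ℝ ∞ f) {p : V} {C : ℝ}
    (h : ∀ q, ‖q - p‖ ≤ L.length → ‖L.foldr (fun i => dirDeriv (v i)) f q‖ ≤ C) :
    ‖L.foldr (fun i => stepDiff (v i)) f p‖ ≤ C := by
  induction L generalizing f p with
  | nil => exact h p (by simp)
  | cons i L ih =>
    refine norm_stepDiff_le (hf.foldr_stepDiff v L) fun t ht => ?_
    rw [dirDeriv_foldr_stepDiff v L hf]
    refine ih (hf.dirDeriv (v i)) fun q hq => ?_
    rw [← dirDeriv_foldr_comm v L hf]
    refine h q ?_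
    have hstep : ‖t • v i‖ ≤ 1 := by
      rw [norm_smul, Real.norm_of_nonneg ht.1]
      exact mul_le_one₀ ht.2 (norm_nonneg _) (hv i)
    calc ‖q - p‖ = ‖(q - (p + t • v i)) + t • v i‖ := by congr 1; abel
      _ ≤ L.length + 1 := (norm_add_le _ _).trans (add_le_add hq hstep)
      _ = (i :: L).length := by simp

end DirectionalDerivative

section Coordinates

variable {n : ℕ} {V E : Type*} [NormedAddCommGroup V] [NormedSpace ℝ V]
  [NormedAddCommGroup E] [NormedSpace ℝ E]

theorem pDeriv_comp {j : (Fin n → ℝ) → V} {J : (Fin n → ℝ) →L[ℝ] V}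
    (hj : ∀ x, HasFDerivAt j J x) {G : V → E} (hG : ContDiff ℝ ∞ G) (i : Fin n) :
    pDeriv i (G ∘ j) = dirDeriv (J (Pi.single i 1)) G ∘ j := by
  funext x
  have hu := hasDerivAt_update x i (x i)
  have hx : Function.update x i (x i) = x := Function.update_eq_self i x
  have hGj : HasFDerivAt (G ∘ j) ((fderiv ℝ G (j x)).comp J) (Function.update x i (x i)) := by
    rw [hx]
    exact ((hG.differentiable (by simp)) (j x)).hasFDerivAt.comp x (hj x)
  exact (hGj.comp_hasDerivAt (x i) hu).deriv

theorem mDeriv_comp {j : (Fin n → ℝ) → V} {J : (Fin n → ℝ) →L[ℝ] V}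
    (hj : ∀ x, HasFDerivAt j J x) {G : V → E} (hG : ContDiff ℝ ∞ G) (α : Fin n → ℕ) :
    mDeriv α (G ∘ j) =
      (multiIndexList α).foldr (fun i => dirDeriv (J (Pi.single i 1))) G ∘ j := by
  rw [mDeriv, foldr_iterate_eq_foldr_flatMap, ← multiIndexList]
  induction multiIndexList α with
  | nil => rfl
  | cons i L ih =>
    rw [List.foldr_cons, List.foldr_cons, ih, pDeriv_comp hj (hG.foldr_dirDeriv _ L)]

theorem mFwdDiff_comp_intCast {F : Type*} [AddCommGroup F] (g : (Fin n → ℝ) → F)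
    (α : Fin n → ℕ) (ξ : Fin n → ℤ) :
    mFwdDiff α (fun ξ' => g fun i => (ξ' i : ℝ)) ξ =
      (multiIndexList α).foldr (fun i => stepDiff (Pi.single i (1 : ℝ))) g
        fun i => (ξ i : ℝ) := by
  rw [mFwdDiff, foldr_iterate_eq_foldr_flatMap, ← multiIndexList]
  induction multiIndexList α generalizing ξ with
  | nil => rfl
  | cons i L ih =>
    rw [List.foldr_cons, List.foldr_cons, fwdDiffInt, stepDiff, ih, ih]
    congr 2
    refine congrArg _ (funext fun k => ?_)
    by_cases hk : k = i
    · subst hk; simp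
    · simp [hk]

theorem one_add_sum_sq_le {N : ℝ} {ξ η : Fin n → ℝ} (h : ‖η - ξ‖ ≤ N) :
    1 + ∑ i, η i ^ 2 ≤ 2 * (1 + n * N ^ 2) * (1 + ∑ i, ξ i ^ 2) := by
  have hterm (i : Fin n) : η i ^ 2 ≤ 2 * ξ i ^ 2 + 2 * N ^ 2 := by
    have hi : |η i - ξ i| ≤ N := (norm_le_pi_norm (η - ξ) i).trans h
    have := sq_le_sq' (abs_le.mp hi).1 (abs_le.mp hi).2
    nlinarith [sq_nonneg (η i - 2 * ξ i)]
  have hsum : ∑ i, η i ^ 2 ≤ 2 * ∑ i, ξ i ^ 2 + n * (2 * N ^ 2) := by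
    refine (Finset.sum_le_sum fun i _ => hterm i).trans_eq ?_
    simp [Finset.sum_add_distrib, Finset.mul_sum]
  have h0 : 0 ≤ ∑ i, ξ i ^ 2 := Finset.sum_nonneg fun i _ => sq_nonneg _
  have h1 : 0 ≤ (n : ℝ) * N ^ 2 * ∑ i, ξ i ^ 2 := by positivity
  nlinarith

/-- Peetre-type inequality: powers of `1 + ‖ξ‖²` are comparable at bounded distance. -/
theorem rpow_one_add_sum_sq_le {N : ℝ} {ξ η : Fin n → ℝ} (h : ‖η - ξ‖ ≤ N) (s : ℝ) :
    (1 + ∑ i, η i ^ 2) ^ s ≤ (2 * (1 + n * N ^ 2)) ^ |s| * (1 + ∑ i, ξ i ^ 2) ^ s := by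
  have hpos (ζ : Fin n → ℝ) : 0 < 1 + ∑ i, ζ i ^ 2 :=
    add_pos_of_pos_of_nonneg one_pos (Finset.sum_nonneg fun i _ => sq_nonneg _)
  have hK : 0 < 2 * (1 + n * N ^ 2) := by positivity
  rcases le_total 0 s with hs | hs
  · rw [abs_of_nonneg hs, ← Real.mul_rpow hK.le (hpos ξ).le]
    exact Real.rpow_le_rpow (hpos η).le (one_add_sum_sq_le h) hs
  · have hle := one_add_sum_sq_le (norm_sub_rev η ξ ▸ h)
    have hp := Real.rpow_le_rpow_of_nonpos (hpos ξ) hle hs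
    rw [Real.mul_rpow hK.le (hpos η).le] at hp
    calc (1 + ∑ i, η i ^ 2) ^ s
        = (2 * (1 + n * N ^ 2)) ^ |s| * ((2 * (1 + n * N ^ 2)) ^ s * (1 + ∑ i, η i ^ 2) ^ s) := by
          rw [← mul_assoc, ← Real.rpow_add hK, abs_of_nonpos hs, neg_add_cancel, Real.rpow_zero,
            one_mul]
      _ ≤ _ := by gcongr

end Coordinates

/-- a smooth Euclidean symbol of class `S^m_{ρ,δ}` which is 1-periodic in
each coordinate of `x` restricts to a toroidal symbol on `ℝⁿ × ℤⁿ` satisfying the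
toroidal symbol estimates of class `S^m_{ρ,δ}`. -/
theorem euclidean_symbol_restricts_to_toroidal {n : ℕ} (m ρ δ : ℝ)
    (hρ : 0 < ρ) (hρ1 : ρ ≤ 1) (hδ : 0 ≤ δ) (hδ1 : δ ≤ 1)
    (a : (Fin n → ℝ) → (Fin n → ℝ) → ℂ)
    (ha : ContDiff ℝ (⊤ : ℕ∞) (fun p : (Fin n → ℝ) × (Fin n → ℝ) => a p.1 p.2))
    (hper : ∀ (x ξ : Fin n → ℝ) (i : Fin n),
      a (Function.update x i (x i + 1)) ξ = a x ξ)
    (hbound : ∀ α β : Fin n → ℕ, ∃ c : ℝ, ∀ x ξ : Fin n → ℝ,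
      ‖mixedDeriv β α a x ξ‖ ≤
        c * (1 + ∑ i, ξ i ^ 2) ^ ((m - ρ * (∑ i, α i : ℝ) + δ * (∑ i, β i : ℝ)) / 2)) :
    ∀ α β : Fin n → ℕ, ∃ c : ℝ, ∀ (x : Fin n → ℝ) (ξ : Fin n → ℤ),
      ‖mFwdDiff α (fun ξ' => mDeriv β (fun x' => a x' (fun i => (ξ' i : ℝ))) x) ξ‖ ≤
        c * (1 + ∑ i, (ξ i : ℝ) ^ 2) ^
          ((m - ρ * (∑ i, α i : ℝ) + δ * (∑ i, β i : ℝ)) / 2) := by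
  intro α β
  obtain ⟨c, hc⟩ := hbound α β
  set s : ℝ := (m - ρ * (∑ i, α i : ℝ) + δ * (∑ i, β i : ℝ)) / 2
  set A : (Fin n → ℝ) × (Fin n → ℝ) → ℂ := fun p => a p.1 p.2
  have hfst (ξ x : Fin n → ℝ) : HasFDerivAt (fun x' => (x', ξ))
      (ContinuousLinearMap.inl ℝ (Fin n → ℝ) (Fin n → ℝ)) x := hasFDerivAt_prodMk_left x ξ
  have hsnd (x ξ : Fin n → ℝ) : HasFDerivAt (fun ξ' => (x, ξ'))
      (ContinuousLinearMap.inr ℝ (Fin n → ℝ) (Fin n → ℝ)) ξ := hasFDerivAt_prodMk_right x ξ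
  have hid (ξ : Fin n → ℝ) : HasFDerivAt (fun ξ' : Fin n → ℝ => ξ')
      (ContinuousLinearMap.id ℝ (Fin n → ℝ)) ξ := hasFDerivAt_id ξ
  set B := (multiIndexList β).foldr
    (fun i => dirDeriv (ContinuousLinearMap.inl ℝ (Fin n → ℝ) (Fin n → ℝ) (Pi.single i 1))) A
  have hB : ContDiff ℝ ∞ B := ha.foldr_dirDeriv _ _
  have hBa (x ξ : Fin n → ℝ) : mDeriv β (fun x' => a x' ξ) x = B (x, ξ) :=
    congrFun (mDeriv_comp (hfst ξ) ha β) x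
  have hmixed (x ξ : Fin n → ℝ) :
      mDeriv α (fun ξ' => B (x, ξ')) ξ = mixedDeriv β α a x ξ := by
    have hinner : (fun x' => mDeriv α (a x') ξ) = _ ∘ fun x' => (x', ξ) :=
      funext fun x' => congrFun (mDeriv_comp (hsnd x') ha α) ξ
    rw [mixedDeriv, hinner, mDeriv_comp (hfst ξ) (ha.foldr_dirDeriv _ _),
      foldr_dirDeriv_comm _ _ _ _ ha]
    exact congrFun (mDeriv_comp (hsnd x) hB α) ξ
  refine ⟨|c| * (2 * (1 + n * ((multiIndexList α).length : ℝ) ^ 2)) ^ |s|, fun x ξ => ?_⟩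
  have hBx : ContDiff ℝ ∞ fun ξ' => B (x, ξ') := hB.comp (contDiff_prodMk_right x)
  simp only [hBa]
  rw [mFwdDiff_comp_intCast fun ξ' => B (x, ξ')]
  have hunit (i : Fin n) : ‖(Pi.single i 1 : Fin n → ℝ)‖ ≤ 1 := by
    rw [Pi.norm_single, norm_one]
  refine norm_foldr_stepDiff_le hunit _ hBx fun η hη => ?_
  have hη' := congrFun (mDeriv_comp hid hBx α) η
  refine (congrArg norm (hη'.symm.trans (hmixed x η))).trans_le ((hc x η).trans ?_)
  have hpow : 0 ≤ (1 + ∑ i, η i ^ 2) ^ s :=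
    Real.rpow_nonneg (add_nonneg zero_le_one (Finset.sum_nonneg fun i _ => sq_nonneg _)) s
  rw [mul_assoc]
  exact (mul_le_mul_of_nonneg_right (le_abs_self c) hpow).trans
    (mul_le_mul_of_nonneg_left (rpow_one_add_sum_sq_le hη s) (abs_nonneg c))
end
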